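/- Let G be a cograph with diameter 2 belonging to 𝒢₁(n, n−3) with n ≥ 5, and let P₃ = v₁v₂v₃ be a diametrical path of G (so v₁ and v₃ are at distance 2). If S_{{v₁,v₂}} ≠ ∅, then S_{{v₂,v₃}} = ∅. -/

import Mathlib

open Matrix

/-- The normalized Laplacian matrix of a finite simple graph. -/
noncomputable def normLap {V : Type*} [Fintype V] [DecidableEq V] (G : SimpleGraph V) [DecidableRel G.Adj] :
    Matrix V V ℝ :=
  Matrix.of fun u v =>
    if u = v then 1
    else if G.Adj u v then -1 / Real.sqrt ((G.degree u : ℝ) * (G.degree v : ℝ))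
    else 0

/-- The (geometric) multiplicity of `μ` as an eigenvalue of the matrix `M`. -/
noncomputable def eigMult {V : Type*} [Fintype V] [DecidableEq V]
    (M : Matrix V V ℝ) (μ : ℝ) : ℕ :=
  Module.finrank ℝ (LinearMap.ker (M - μ • (1 : Matrix V V ℝ)).mulVecLin)

/-- The multiset of eigenvalues (with multiplicity) of a hermitian matrix. -/
noncomputable def eigMultiset {V : Type*} [Fintype V] [DecidableEq V]
    (M : Matrix V V ℝ) : Multiset ℝ :=
  if h : M.IsHermitian then Finset.univ.val.map h.eigenvalues else 0

/-- The second-smallest eigenvalue (counted with multiplicity) of a hermitian matrix. -/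
noncomputable def secondSmallestEig {V : Type*} [Fintype V] [DecidableEq V]
    (M : Matrix V V ℝ) : ℝ :=
  ((eigMultiset M).sort (· ≤ ·)).getD 1 0

/-- The independence number of a finite simple graph. -/
noncomputable def indepNum {V : Type*} [Fintype V] (G : SimpleGraph V) : ℕ :=
  sSup {k | ∃ s : Finset V, (∀ u ∈ s, ∀ v ∈ s, u ≠ v → ¬ G.Adj u v) ∧ s.card = k}

/-- `G ∈ 𝒢₁(n, n-3)`. -/
def memG1Family {V : Type*} [Fintype V] [DecidableEq V]
    (G : SimpleGraph V) [DecidableRel G.Adj] (n : ℕ) : Prop :=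
  G.Connected ∧ Fintype.card V = n ∧
    (∃ θ : ℝ, eigMult (normLap G) θ = n - 3) ∧
    secondSmallestEig (normLap G) ≠ 1 ∧
    indepNum G = 2

/-- `v₁v₂v₃v₄` is an induced path `P₄`. -/
def IsInducedP4 {V : Type*} (G : SimpleGraph V) (v1 v2 v3 v4 : V) : Prop :=
  G.Adj v1 v2 ∧ G.Adj v2 v3 ∧ G.Adj v3 v4 ∧
    ¬ G.Adj v1 v3 ∧ ¬ G.Adj v1 v4 ∧ ¬ G.Adj v2 v4

/-- A cograph: no induced path on 4 vertices. -/
def IsCograph {V : Type*} (G : SimpleGraph V) : Prop :=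
  ∀ a b c d : V, ¬ IsInducedP4 G a b c d

/-- `S_U`: vertices outside the path `P` whose neighborhood inside `P` is exactly `U`. -/
def Sset {V : Type*} (G : SimpleGraph V) (P U : Set V) : Set V :=
  {u | u ∉ P ∧ G.neighborSet u ∩ P = U}

/-- The graph `G₁`: two cliques `A` (of size `a+1`) and `B` (of size `b+1`) forming a complete
graph together, a vertex `u` joined to all of `A` and a vertex `w` joined to all of `B`. -/
def graphG1 (a b : ℕ) : SimpleGraph (Unit ⊕ (Fin (a + 1) ⊕ (Fin (b + 1) ⊕ Unit))) :=
  SimpleGraph.fromRel fun x y =>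
    match x, y with
    | Sum.inl _, Sum.inr (Sum.inl _) => True
    | Sum.inr (Sum.inl _), Sum.inr (Sum.inl _) => True
    | Sum.inr (Sum.inl _), Sum.inr (Sum.inr (Sum.inl _)) => True
    | Sum.inr (Sum.inr (Sum.inl _)), Sum.inr (Sum.inr (Sum.inl _)) => True
    | Sum.inr (Sum.inr (Sum.inl _)), Sum.inr (Sum.inr (Sum.inr _)) => True
    | _, _ => False

noncomputable instance (a b : ℕ) : DecidableRel (graphG1 a b).Adj := Classical.decRel _

/-- The graph `G₂` on `m + 2` vertices: a complete graph on `m + 1` vertices together with a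
pendant vertex attached to one of its vertices. -/
def graphG2 (m : ℕ) : SimpleGraph (Unit ⊕ Fin (m + 1)) :=
  SimpleGraph.fromRel fun x y =>
    match x, y with
    | Sum.inl _, Sum.inr j => j = 0
    | Sum.inr _, Sum.inr _ => True
    | _, _ => False

noncomputable instance (m : ℕ) : DecidableRel (graphG2 m).Adj := Classical.decRel _

/-- The join of a single vertex with the disjoint union of two complete graphs `K_m`. -/
def joinTwoCliques (m : ℕ) : SimpleGraph (Unit ⊕ (Fin m ⊕ Fin m)) :=
  SimpleGraph.fromRel fun x y =>
    match x, y with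
    | Sum.inl _, Sum.inr _ => True
    | Sum.inr (Sum.inl _), Sum.inr (Sum.inl _) => True
    | Sum.inr (Sum.inr _), Sum.inr (Sum.inr _) => True
    | _, _ => False

noncomputable instance (m : ℕ) : DecidableRel (joinTwoCliques m).Adj := Classical.decRel _

/-- The symmetric matrix `A - c D`, with `A` the adjacency matrix and `D` the degree matrix. -/
noncomputable def adjSubDeg {V : Type*} [Fintype V] [DecidableEq V] (G : SimpleGraph V)
    [DecidableRel G.Adj] (c : ℝ) : Matrix V V ℝ :=
  Matrix.of fun u v =>
    if u = v then -(c * G.degree u) else if G.Adj u v then 1 else 0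

/-- `G` is the join of the graph induced on `R` with the disjoint union of two cliques on
`A` and `B`, each having at least two vertices. -/
structure IsJoinTwoCliques {V : Type*} (G : SimpleGraph V) (A B R : Finset V) : Prop where
  cover : ∀ u, u ∈ A ∨ u ∈ B ∨ u ∈ R
  disjAB : ∀ u ∈ A, u ∉ B
  disjAR : ∀ u ∈ A, u ∉ R
  disjBR : ∀ u ∈ B, u ∉ R
  cliqueA : ∀ u ∈ A, ∀ v ∈ A, u ≠ v → G.Adj u v
  cliqueB : ∀ u ∈ B, ∀ v ∈ B, u ≠ v → G.Adj u v
  not_adj : ∀ u ∈ A, ∀ v ∈ B, ¬ G.Adj u v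
  adjAR : ∀ u ∈ A, ∀ v ∈ R, G.Adj u v
  adjBR : ∀ u ∈ B, ∀ v ∈ R, G.Adj u v
  cardA : 1 < A.card
  cardB : 1 < B.card
  nonempty : R.Nonempty

namespace IsJoinTwoCliques

variable {V : Type*} {G : SimpleGraph V} {A B R : Finset V}

theorem symm (h : IsJoinTwoCliques G A B R) : IsJoinTwoCliques G B A R where
  cover u := by rcases h.cover u with h | h | h <;> simp [h]
  disjAB u hu hu' := h.disjAB u hu' hu
  disjAR := h.disjBR
  disjBR := h.disjAR
  cliqueA := h.cliqueB
  cliqueB := h.cliqueA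
  not_adj u hu v hv e := h.not_adj v hv u hu e.symm
  adjAR := h.adjBR
  adjBR := h.adjAR
  cardA := h.cardB
  cardB := h.cardA
  nonempty := h.nonempty

variable [Fintype V] [DecidableEq V]

theorem degree_left [DecidableRel G.Adj] (h : IsJoinTwoCliques G A B R) {u : V} (hu : u ∈ A) :
    G.degree u + 1 = A.card + R.card := by
  have hN : insert u (G.neighborFinset u) = A ∪ R := by
    ext v
    simp only [Finset.mem_insert, SimpleGraph.mem_neighborFinset, Finset.mem_union]
    constructor
    · rintro (rfl | e)
      · exact Or.inl hu
      · rcases h.cover v with hv | hv | hv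
        · exact Or.inl hv
        · exact absurd e (h.not_adj u hu v hv)
        · exact Or.inr hv
    · rintro (hv | hv)
      · by_cases e : u = v
        · exact Or.inl e.symm
        · exact Or.inr (h.cliqueA u hu v hv e)
      · exact Or.inr (h.adjAR u hu v hv)
  have hc := congrArg Finset.card hN
  rw [Finset.card_insert_of_notMem (by simp), SimpleGraph.card_neighborFinset_eq_degree,
    Finset.card_union_of_disjoint (Finset.disjoint_left.2 h.disjAR)] at hc
  exact hc

theorem card_eq (h : IsJoinTwoCliques G A B R) : Fintype.card V = A.card + B.card + R.card := by
  have hN : (Finset.univ : Finset V) = (A ∪ B) ∪ R := by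
    ext v
    have := h.cover v
    simp only [Finset.mem_univ, Finset.mem_union, true_iff]
    tauto
  rw [← Finset.card_univ, hN, Finset.card_union_of_disjoint, Finset.card_union_of_disjoint]
  · exact Finset.disjoint_left.2 h.disjAB
  · refine Finset.disjoint_left.2 fun u hu => ?_
    rcases Finset.mem_union.1 hu with hu | hu
    exacts [h.disjAR u hu, h.disjBR u hu]

theorem degree_join [DecidableRel G.Adj] (h : IsJoinTwoCliques G A B R)
    (hR : ∀ w ∈ R, ∀ w' ∈ R, w ≠ w' → G.Adj w w') {w : V} (hw : w ∈ R) :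
    G.degree w + 1 = A.card + B.card + R.card := by
  have hN : insert w (G.neighborFinset w) = Finset.univ := by
    ext v
    simp only [Finset.mem_insert, SimpleGraph.mem_neighborFinset, Finset.mem_univ, iff_true]
    by_cases e : v = w
    · exact Or.inl e
    · rcases h.cover v with hv | hv | hv
      exacts [Or.inr (h.adjAR v hv w hw).symm, Or.inr (h.adjBR v hv w hw).symm,
        Or.inr (hR w hw v hv (Ne.symm e))]
  have hc := congrArg Finset.card hN
  rw [Finset.card_insert_of_notMem (by simp), SimpleGraph.card_neighborFinset_eq_degree,
    Finset.card_univ, h.card_eq] at hc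
  exact hc

end IsJoinTwoCliques

theorem adjSubDeg_self {V : Type*} [Fintype V] [DecidableEq V] (G : SimpleGraph V)
    [DecidableRel G.Adj] (c : ℝ) (u : V) : adjSubDeg G c u u = -(c * G.degree u) := by
  simp [adjSubDeg]

theorem adjSubDeg_of_adj {V : Type*} [Fintype V] [DecidableEq V] {G : SimpleGraph V}
    [DecidableRel G.Adj] (c : ℝ) {u v : V} (h : G.Adj u v) : adjSubDeg G c u v = 1 := by
  simp [adjSubDeg, h.ne, h]

theorem adjSubDeg_of_not_adj {V : Type*} [Fintype V] [DecidableEq V] {G : SimpleGraph V}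
    [DecidableRel G.Adj] (c : ℝ) {u v : V} (hne : u ≠ v) (h : ¬ G.Adj u v) :
    adjSubDeg G c u v = 0 := by
  simp [adjSubDeg, hne, h]

theorem det_submatrix_eq_zero_of_rank_lt {V : Type*} [Fintype V] [DecidableEq V]
    {M : Matrix V V ℝ} {k : ℕ} (hM : M.rank < k) (f g : Fin k → V) :
    (M.submatrix f g).det = 0 := by
  by_contra hdet
  have h1 : (M.submatrix f g).rank = k := by
    simpa using Matrix.rank_of_isUnit _ ((Matrix.isUnit_iff_isUnit_det _).2 (Ne.isUnit hdet))
  have h2 : (M.submatrix f g).rank ≤ M.rank := Matrix.rank_submatrix_le _ _ _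
  omega

theorem det_fin_four (M : Matrix (Fin 4) (Fin 4) ℝ) :
    M.det =
      M 0 0 * (M 1 1 * (M 2 2 * M 3 3 - M 2 3 * M 3 2) - M 1 2 * (M 2 1 * M 3 3 - M 2 3 * M 3 1)
        + M 1 3 * (M 2 1 * M 3 2 - M 2 2 * M 3 1))
      - M 0 1 * (M 1 0 * (M 2 2 * M 3 3 - M 2 3 * M 3 2) - M 1 2 * (M 2 0 * M 3 3 - M 2 3 * M 3 0)
        + M 1 3 * (M 2 0 * M 3 2 - M 2 2 * M 3 0))
      + M 0 2 * (M 1 0 * (M 2 1 * M 3 3 - M 2 3 * M 3 1) - M 1 1 * (M 2 0 * M 3 3 - M 2 3 * M 3 0)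
        + M 1 3 * (M 2 0 * M 3 1 - M 2 1 * M 3 0))
      - M 0 3 * (M 1 0 * (M 2 1 * M 3 2 - M 2 2 * M 3 1) - M 1 1 * (M 2 0 * M 3 2 - M 2 2 * M 3 0)
        + M 1 2 * (M 2 0 * M 3 1 - M 2 1 * M 3 0)) := by
  simp [Matrix.det_succ_row_zero, Fin.sum_univ_succ, Fin.succAbove]
  ring

namespace IsJoinTwoCliques

variable {V : Type*} [Fintype V] [DecidableEq V] {G : SimpleGraph V} [DecidableRel G.Adj]
  {A B R : Finset V} {c : ℝ}

theorem adjSubDeg_left_right (h : IsJoinTwoCliques G A B R) {u v : V} (hu : u ∈ A) (hv : v ∈ B) :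
    adjSubDeg G c u v = 0 :=
  adjSubDeg_of_not_adj c (fun e => h.disjAB u hu (e ▸ hv)) (h.not_adj u hu v hv)

theorem adjSubDeg_left_join (h : IsJoinTwoCliques G A B R) {u v : V} (hu : u ∈ A) (hv : v ∈ R) :
    adjSubDeg G c u v = 1 :=
  adjSubDeg_of_adj c (h.adjAR u hu v hv)

theorem adjSubDeg_join_left (h : IsJoinTwoCliques G A B R) {u v : V} (hu : u ∈ A) (hv : v ∈ R) :
    adjSubDeg G c v u = 1 :=
  adjSubDeg_of_adj c (h.adjAR u hu v hv).symm

theorem adjSubDeg_left (h : IsJoinTwoCliques G A B R) {u v : V} (hu : u ∈ A) (hv : v ∈ A)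
    (huv : u ≠ v) : adjSubDeg G c u v = 1 :=
  adjSubDeg_of_adj c (h.cliqueA u hu v hv huv)

theorem degree_eq (h : IsJoinTwoCliques G A B R) {u v : V} (hu : u ∈ A) (hv : v ∈ A) :
    G.degree u = G.degree v := by
  have := h.degree_left hu
  have := h.degree_left hv
  omega

/-- The determinant condition on two vertices in each clique. -/
theorem sq_eq_one_or (h : IsJoinTwoCliques G A B R) (hrank : (adjSubDeg G c).rank < 4)
    {a a' b b' : V} (ha : a ∈ A) (ha' : a' ∈ A) (haa : a ≠ a') (hb : b ∈ B) (hb' : b' ∈ B)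
    (hbb : b ≠ b') :
    (c * G.degree a) ^ 2 = 1 ∨ (c * G.degree b) ^ 2 = 1 := by
  have key := det_submatrix_eq_zero_of_rank_lt hrank ![a, a', b, b'] ![a, a', b, b']
  rw [det_fin_four] at key
  simp [adjSubDeg_self, h.adjSubDeg_left_right, h.symm.adjSubDeg_left_right, h.adjSubDeg_left,
    h.symm.adjSubDeg_left, ha, ha', hb, hb', haa, haa.symm, hbb, hbb.symm, h.degree_eq ha' ha,
    h.symm.degree_eq hb' hb] at key
  have : ((c * G.degree a) ^ 2 - 1) * ((c * G.degree b) ^ 2 - 1) = 0 := by linear_combination key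
  exact (mul_eq_zero.1 this).imp sub_eq_zero.1 sub_eq_zero.1

theorem mul_degree_eq_neg_one (h : IsJoinTwoCliques G A B R) (hrank : (adjSubDeg G c).rank < 4)
    {a : V} (ha : a ∈ A) (hsq : (c * G.degree a) ^ 2 = 1) : c * G.degree a = -1 := by
  refine (sq_eq_sq_iff_eq_or_eq_neg.1 (hsq.trans (one_pow 2).symm)).resolve_left fun h1 => ?_
  obtain ⟨a', ha', haa⟩ := Finset.exists_mem_ne h.cardA a
  obtain ⟨b, hb⟩ := Finset.card_pos.1 (by have := h.cardB; omega : 0 < B.card)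
  obtain ⟨w, hw⟩ := h.nonempty
  have key := det_submatrix_eq_zero_of_rank_lt hrank ![a, a', w, b] ![a, a', w, b]
  rw [det_fin_four] at key
  simp [adjSubDeg_self, h.adjSubDeg_left_right, h.symm.adjSubDeg_left_right, h.adjSubDeg_left,
    h.adjSubDeg_left_join, h.symm.adjSubDeg_left_join, h.adjSubDeg_join_left,
    h.symm.adjSubDeg_join_left, ha, ha', hb, hw, haa, haa.symm, h.degree_eq ha' ha, h1] at key
  have hb0 := h.symm.degree_left hb
  have := h.cardB
  have h0 : c * (G.degree b : ℝ) = 0 := by linear_combination -key / 4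
  rcases mul_eq_zero.1 h0 with rfl | h0
  · simp at h1
  · have : G.degree b = 0 := by exact_mod_cast h0
    omega

/-- The case of equal cliques and a single joining vertex. -/
theorem rank_lt_three (h : IsJoinTwoCliques G A B R) {a : V} (ha : a ∈ A)
    (hc : c * G.degree a = -1) (hAB : A.card = B.card) (hR : R.card = 1) :
    (adjSubDeg G c).rank < 3 := by
  obtain ⟨w, rfl⟩ := Finset.card_eq_one.1 hR
  have hw : w ∈ ({w} : Finset V) := by simp
  have hda := h.degree_left ha
  have hdw := h.degree_join (by simp) hw
  have hA : ∀ u ∈ A, c * G.degree u = -1 := fun u hu => by rw [h.degree_eq hu ha, hc]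
  have hB : ∀ u ∈ B, c * G.degree u = -1 := fun u hu => by
    have := h.symm.degree_left hu
    rw [show G.degree u = G.degree a by omega, hc]
  have hW : c * G.degree w = -2 := by
    rw [show G.degree w = 2 * G.degree a by omega]
    push_cast
    linear_combination 2 * hc
  let C : Matrix V (Fin 2) ℝ := Matrix.of fun u =>
    ![if u ∈ B then 0 else 1, if u ∈ A then 0 else 1]
  have hM : adjSubDeg G c = C * Cᵀ := by
    ext u v
    simp only [Matrix.mul_apply, Fin.sum_univ_two, Matrix.transpose_apply, C, Matrix.of_apply,
      Matrix.cons_val_zero, Matrix.cons_val_one]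
    by_cases huv : u = v
    · subst huv
      rw [adjSubDeg_self]
      rcases h.cover u with hu | hu | hu
      · simp [hu, h.disjAB u hu, hA u hu]
      · simp [hu, h.symm.disjAB u hu, hB u hu]
      · have h1 : u ∉ A := fun e => h.disjAR u e hu
        have h2 : u ∉ B := fun e => h.disjBR u e hu
        rw [Finset.mem_singleton] at hu
        subst hu
        simp [h1, h2, hW]
        norm_num
    · have hwA : w ∉ A := fun e => h.disjAR w e hw
      have hwB : w ∉ B := fun e => h.disjBR w e hw
      rcases h.cover u with hu | hu | hu <;> rcases h.cover v with hv | hv | hv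
      · simp [hu, hv, h.disjAB, h.adjSubDeg_left, huv]
      · simp [hu, hv, h.disjAB, h.symm.disjAB v hv, h.adjSubDeg_left_right]
      · rw [Finset.mem_singleton] at hv
        subst hv
        simp [hu, h.disjAB, h.adjSubDeg_left_join, hwA, hwB]
      · simp [hu, hv, h.disjAB, h.symm.disjAB u hu, h.symm.adjSubDeg_left_right]
      · simp [hu, hv, h.symm.disjAB, h.symm.adjSubDeg_left, huv]
      · rw [Finset.mem_singleton] at hv
        subst hv
        simp [hu, h.symm.disjAB, h.symm.adjSubDeg_left_join, hwA, hwB]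
      · rw [Finset.mem_singleton] at hu
        subst hu
        simp [hv, h.disjAB, h.adjSubDeg_join_left, hwA, hwB]
      · rw [Finset.mem_singleton] at hu
        subst hu
        simp [hv, h.symm.disjAB, h.symm.adjSubDeg_join_left, hwA, hwB]
      · simp only [Finset.mem_singleton] at hu hv
        exact absurd (hu.trans hv.symm) huv
  have h1 := Matrix.rank_mul_le_left C Cᵀ
  have h2 := Matrix.rank_le_card_width C
  rw [Fintype.card_fin] at h2
  rw [hM]
  omega

/-- If the cliques have the same size, there is a single joining vertex. -/
theorem card_join_eq_one (h : IsJoinTwoCliques G A B R) (hrank : (adjSubDeg G c).rank < 4)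
    {a : V} (ha : a ∈ A) (hc : c * G.degree a = -1) (hAB : A.card = B.card) : R.card = 1 := by
  obtain ⟨b, hb⟩ := Finset.card_pos.1 (by have := h.cardB; omega : 0 < B.card)
  have hda := h.degree_left ha
  have hdb := h.symm.degree_left hb
  have hcb : c * G.degree b = -1 := by rw [show G.degree b = G.degree a by omega, hc]
  have hA2 := h.cardA
  have hR0 := h.nonempty.card_pos
  have key : ∀ w ∈ R, ∀ w' ∈ R, w ≠ w' →
      (c * G.degree w + 2) * (c * G.degree w' + 2) = (adjSubDeg G c w w' - 2) ^ 2 := by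
    intro w hw w' hw' hww
    have hs : adjSubDeg G c w' w = adjSubDeg G c w w' := by
      simp [adjSubDeg, hww, hww.symm, G.adj_comm]
    have key := det_submatrix_eq_zero_of_rank_lt hrank ![a, b, w, w'] ![a, b, w, w']
    rw [det_fin_four] at key
    simp [adjSubDeg_self, h.adjSubDeg_left_right, h.symm.adjSubDeg_left_right,
      h.adjSubDeg_left_join, h.symm.adjSubDeg_left_join, h.adjSubDeg_join_left,
      h.symm.adjSubDeg_join_left, ha, hb, hw, hw', hc, hcb, hs] at key
    linear_combination key
  have scale : ∀ w w', (G.degree w - 2 * G.degree a : ℝ) * (G.degree w' - 2 * G.degree a) =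
      (c * G.degree w + 2) * (c * G.degree w' + 2) * G.degree a ^ 2 := by
    intro w w'
    linear_combination (-(c * G.degree a - 1) * G.degree w * G.degree w'
      - 2 * G.degree w * G.degree a - 2 * G.degree w' * G.degree a) * hc
  have hadj : ∀ w ∈ R, ∀ w' ∈ R, w ≠ w' → G.Adj w w' := by
    intro w hw w' hw' hww
    by_contra hn
    have hk := key w hw w' hw' hww
    rw [adjSubDeg_of_not_adj c hww hn] at hk
    have hs := scale w w'
    rw [hk] at hs
    have hle : ∀ u ∈ R, 0 < (G.degree u : ℝ) ∧ (G.degree u : ℝ) ≤ 2 * G.degree a := by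
      intro u hu
      have h1 : 0 < G.degree u := (G.degree_pos_iff_exists_adj u).2 ⟨a, (h.adjAR a ha u hu).symm⟩
      have h2 := G.degree_lt_card_verts u
      rw [h.card_eq] at h2
      have h3 : G.degree u ≤ 2 * G.degree a := by omega
      exact ⟨by exact_mod_cast h1, by exact_mod_cast h3⟩
    obtain ⟨h1, h2⟩ := hle w hw
    obtain ⟨h3, h4⟩ := hle w' hw'
    nlinarith [mul_nonneg h1.le (sub_nonneg.2 h4), mul_pos h3 (h1.trans_le h2)]
  by_contra hR1
  obtain ⟨w, hw, w', hw', hww⟩ := Finset.one_lt_card.1 (by omega : 1 < R.card)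
  have hk := key w hw w' hw' hww
  rw [adjSubDeg_of_adj c (hadj w hw w' hw' hww)] at hk
  have hs := scale w w'
  rw [hk] at hs
  have hdw : (G.degree w + 1 : ℝ) = A.card + B.card + R.card := by
    exact_mod_cast h.degree_join hadj hw
  have hdw' : (G.degree w' + 1 : ℝ) = A.card + B.card + R.card := by
    exact_mod_cast h.degree_join hadj hw'
  have hda' : (G.degree a + 1 : ℝ) = A.card + R.card := by exact_mod_cast hda
  have hAB' : (A.card : ℝ) = B.card := by exact_mod_cast hAB
  have hA2' : (2 : ℝ) ≤ A.card := by exact_mod_cast hA2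
  have hRpos : (1 : ℝ) ≤ R.card := by exact_mod_cast hR0
  rw [show (G.degree w : ℝ) = 2 * A.card + R.card - 1 by linarith,
    show (G.degree w' : ℝ) = 2 * A.card + R.card - 1 by linarith,
    show (G.degree a : ℝ) = A.card + R.card - 1 by linarith] at hs
  nlinarith [mul_nonneg (sub_nonneg.2 hA2') (sub_nonneg.2 hRpos)]

/-- The cliques have the same size. -/
theorem card_left_eq_card_right (h : IsJoinTwoCliques G A B R)
    (hrank : (adjSubDeg G c).rank < 4) {a : V} (ha : a ∈ A) (hc : c * G.degree a = -1) :
    A.card = B.card := by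
  by_contra hAB
  obtain ⟨b, hb, b', hb', hbb⟩ := Finset.one_lt_card.1 h.cardB
  have hda := h.degree_left ha
  have hdb := h.symm.degree_left hb
  have ha0 : (0 : ℝ) < G.degree a := by
    have := h.cardA
    exact_mod_cast (by omega : 0 < G.degree a)
  have hc0 : c < 0 := by
    by_contra hc0
    nlinarith [mul_nonneg (not_lt.1 hc0) ha0.le]
  obtain ⟨s, hs⟩ : ∃ s : ℝ, s = -(c * G.degree b) := ⟨_, rfl⟩
  have hs0 : 0 ≤ s := by
    rw [hs]
    nlinarith [mul_nonneg (neg_nonneg.2 hc0.le) (Nat.cast_nonneg (α := ℝ) (G.degree b))]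
  have hs1 : s - 1 ≠ 0 := by
    intro e
    have h1 : c * (G.degree b - G.degree a : ℝ) = 0 := by linear_combination -e + hs - hc
    have h2 : (G.degree b : ℝ) = G.degree a :=
      sub_eq_zero.1 ((mul_eq_zero.1 h1).resolve_left hc0.ne)
    have h3 : G.degree b = G.degree a := by exact_mod_cast h2
    omega
  have hself : ∀ u ∈ B, adjSubDeg G c u u = s := fun u hu => by
    rw [adjSubDeg_self, hs, h.symm.degree_eq hu hb]
  have hB2 : B.card = 2 := by
    by_contra hB2
    obtain ⟨x, y, z, hx, hy, hz, hxy, hxz, hyz⟩ :=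
      Finset.two_lt_card_iff.1 (by have := h.cardB; omega : 2 < B.card)
    have key := det_submatrix_eq_zero_of_rank_lt hrank ![a, x, y, z] ![a, x, y, z]
    rw [det_fin_four] at key
    simp [adjSubDeg_self G c a, hself, h.adjSubDeg_left_right, h.symm.adjSubDeg_left_right,
      h.symm.adjSubDeg_left, ha, hx, hy, hz, hc, hxy, hxz, hyz, hxy.symm, hxz.symm,
      hyz.symm] at key
    have : (s - 1) * ((s - 1) * (s + 2)) = 0 := by linear_combination key
    have := (mul_eq_zero.1 ((mul_eq_zero.1 this).resolve_left hs1)).resolve_left hs1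
    linarith
  have key : ∀ w ∈ R, ∀ w' ∈ R, (s + 1) * (adjSubDeg G c w w' - 1) = 2 := by
    intro w hw w' hw'
    have key := det_submatrix_eq_zero_of_rank_lt hrank ![a, b, b', w] ![a, b, b', w']
    rw [det_fin_four] at key
    simp [adjSubDeg_self G c a, hself, h.adjSubDeg_left_right, h.symm.adjSubDeg_left_right,
      h.symm.adjSubDeg_left, h.adjSubDeg_left_join, h.symm.adjSubDeg_left_join,
      h.adjSubDeg_join_left, h.symm.adjSubDeg_join_left, ha, hb, hb', hw, hw', hc, hbb,
      hbb.symm] at key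
    have : (s - 1) * ((s + 1) * (adjSubDeg G c w w' - 1) - 2) = 0 := by linear_combination key
    exact sub_eq_zero.1 ((mul_eq_zero.1 this).resolve_left hs1)
  have hR : R.card = 1 := by
    by_contra hR
    obtain ⟨w, hw, w', hw', hww⟩ :=
      Finset.one_lt_card.1 (by have := h.nonempty.card_pos; omega : 1 < R.card)
    have hk := key w hw w' hw'
    by_cases e : G.Adj w w'
    · rw [adjSubDeg_of_adj c e] at hk
      linarith
    · rw [adjSubDeg_of_not_adj c hww e] at hk
      linarith
  obtain ⟨w, rfl⟩ := Finset.card_eq_one.1 hR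
  have hk := key w (by simp) w (by simp)
  have hdw := h.degree_join (by simp) (w := w) (by simp)
  rw [adjSubDeg_self, hs, show G.degree b = 2 by omega,
    show G.degree w = G.degree a + 2 by omega] at hk
  push_cast at hk
  have hk' : (1 - 2 * c) * (-2 * c) = 2 := by linear_combination hk + (1 - 2 * c) * hc
  have hd : (G.degree a - 2 : ℝ) * (G.degree a + 1) = 0 := by
    linear_combination -(G.degree a : ℝ) ^ 2 / 2 * hk' +
      (2 * (c * G.degree a - 1) - G.degree a) * hc
  have hd2 : (G.degree a : ℝ) = 2 :=
    sub_eq_zero.1 ((mul_eq_zero.1 hd).resolve_right (by positivity))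
  have hd3 : G.degree a = 2 := by exact_mod_cast hd2
  omega

theorem false_of_rank_eq_three (h : IsJoinTwoCliques G A B R) (hrank : (adjSubDeg G c).rank = 3)
    {a : V} (ha : a ∈ A) (hsq : (c * G.degree a) ^ 2 = 1) : False := by
  have hlt : (adjSubDeg G c).rank < 4 := by omega
  have hc := h.mul_degree_eq_neg_one hlt ha hsq
  have hAB := h.card_left_eq_card_right hlt ha hc
  exact (h.rank_lt_three ha hc hAB (h.card_join_eq_one hlt ha hc hAB)).ne hrank

end IsJoinTwoCliques

theorem rank_adjSubDeg {V : Type*} [Fintype V] [DecidableEq V] (G : SimpleGraph V)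
    [DecidableRel G.Adj] (hdeg : ∀ u, 0 < G.degree u) (θ : ℝ) :
    (adjSubDeg G (1 - θ)).rank = (normLap G - θ • (1 : Matrix V V ℝ)).rank := by
  set D : Matrix V V ℝ := Matrix.diagonal fun u => √(G.degree u : ℝ)
  set E : Matrix V V ℝ := Matrix.diagonal fun u => -√(G.degree u : ℝ)
  have hD : IsUnit D.det := by
    rw [Matrix.det_diagonal, isUnit_iff_ne_zero, Finset.prod_ne_zero_iff]
    intro u _
    have := hdeg u
    positivity
  have hE : IsUnit E.det := by
    rw [Matrix.det_diagonal, isUnit_iff_ne_zero, Finset.prod_ne_zero_iff]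
    intro u _
    have := hdeg u
    exact neg_ne_zero.2 (by positivity)
  have hM : adjSubDeg G (1 - θ) = D * (normLap G - θ • (1 : Matrix V V ℝ)) * E := by
    ext u v
    have hu : 0 < √(G.degree u : ℝ) := by have := hdeg u; positivity
    have hv : 0 < √(G.degree v : ℝ) := by have := hdeg v; positivity
    simp only [D, E, Matrix.mul_diagonal, Matrix.diagonal_mul, Matrix.sub_apply,
      Matrix.smul_apply, Matrix.one_apply, normLap, adjSubDeg, Matrix.of_apply]
    by_cases e : u = v
    · subst e
      have := Real.mul_self_sqrt (Nat.cast_nonneg (α := ℝ) (G.degree u))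
      simp only [if_true, smul_eq_mul]
      linear_combination (1 - θ) * this
    · by_cases e' : G.Adj u v
      · simp only [e, e', if_true, if_false, smul_zero, sub_zero]
        rw [Real.sqrt_mul (Nat.cast_nonneg _)]
        field_simp
      · simp [e, e']
  rw [hM, Matrix.rank_mul_eq_left_of_isUnit_det _ _ hE, Matrix.rank_mul_eq_right_of_isUnit_det _ _ hD]

theorem rank_add_eigMult {V : Type*} [Fintype V] [DecidableEq V] (M : Matrix V V ℝ) (θ : ℝ) :
    (M - θ • (1 : Matrix V V ℝ)).rank + eigMult M θ = Fintype.card V := by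
  have := LinearMap.finrank_range_add_finrank_ker (M - θ • (1 : Matrix V V ℝ)).mulVecLin
  rwa [Module.finrank_fintype_fun_eq_card] at this

theorem adj_of_indepNum_eq_two {V : Type*} [Fintype V] [DecidableEq V] {G : SimpleGraph V}
    (h : indepNum G = 2) {u v w : V} (huv : u ≠ v) (huw : u ≠ w) (hvw : v ≠ w)
    (hnuw : ¬ G.Adj u w) (hnvw : ¬ G.Adj v w) : G.Adj u v := by
  by_contra hnuv
  have hle : 3 ≤ indepNum G := by
    refine le_csSup ⟨Fintype.card V, ?_⟩ ⟨{u, v, w}, ?_, ?_⟩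
    · rintro k ⟨s, -, rfl⟩
      exact s.card_le_univ
    · simp [G.adj_comm, hnuv, hnuw, hnvw]
    · rw [Finset.card_eq_three]
      exact ⟨u, v, w, huv, huw, hvw, rfl⟩
  omega

/-- A cograph of independence number two is, around an induced path, a join of two disjoint
cliques with the common neighbourhood of the end vertices of the path. -/
theorem isJoinTwoCliques_of_isCograph {V : Type*} [Fintype V] [DecidableEq V] {G : SimpleGraph V}
    [DecidableRel G.Adj] (hind : indepNum G = 2) (hco : IsCograph G) {a r b x y : V}
    (hab : a ≠ b) (hnab : ¬ G.Adj a b) (har : G.Adj a r) (hrb : G.Adj r b)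
    (hax : G.Adj a x) (hnxb : ¬ G.Adj x b) (hxb : x ≠ b)
    (hby : G.Adj b y) (hnya : ¬ G.Adj y a) (hya : y ≠ a) :
    IsJoinTwoCliques G {u | u ≠ b ∧ ¬ G.Adj u b} {u | u ≠ a ∧ ¬ G.Adj u a}
      {u | G.Adj u a ∧ G.Adj u b} := by
  have adjA : ∀ u, u ≠ b → ¬ G.Adj u b → u ≠ a → G.Adj u a := fun u h1 h2 h3 =>
    adj_of_indepNum_eq_two hind h3 h1 hab h2 hnab
  have adjB : ∀ u, u ≠ a → ¬ G.Adj u a → u ≠ b → G.Adj u b := fun u h1 h2 h3 =>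
    adj_of_indepNum_eq_two hind h3 h1 hab.symm h2 fun e => hnab e.symm
  constructor
  all_goals try simp only [Finset.mem_filter, Finset.mem_univ, true_and]
  · intro u
    by_cases h1 : u = a
    · subst h1; exact Or.inl ⟨hab, hnab⟩
    by_cases h2 : u = b
    · subst h2; exact Or.inr (Or.inl ⟨hab.symm, fun e => hnab e.symm⟩)
    tauto
  · rintro u ⟨h1, h2⟩ ⟨h3, h4⟩
    exact h4 (adjA u h1 h2 h3)
  · tauto
  · tauto
  · rintro u ⟨h1, h2⟩ v ⟨h3, h4⟩ h
    exact adj_of_indepNum_eq_two hind h h1 h3 h2 h4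
  · rintro u ⟨h1, h2⟩ v ⟨h3, h4⟩ h
    exact adj_of_indepNum_eq_two hind h h1 h3 h2 h4
  · rintro u ⟨h1, h2⟩ v ⟨h3, h4⟩ e
    by_cases hu : u = a
    · subst hu; exact h4 e.symm
    by_cases hv : v = b
    · subst hv; exact h2 e
    exact hco a u v b ⟨(adjA u h1 h2 hu).symm, e, adjB v h3 h4 hv, fun e => h4 e.symm, hnab, h2⟩
  · rintro u ⟨h1, h2⟩ v ⟨h3, h4⟩
    by_contra e
    by_cases hu : u = a
    · subst hu; exact e h3.symm
    exact hco u a v b ⟨adjA u h1 h2 hu, h3.symm, h4, e, h2, hnab⟩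
  · rintro u ⟨h1, h2⟩ v ⟨h3, h4⟩
    by_contra e
    by_cases hu : u = b
    · subst hu; exact e h4.symm
    exact hco u b v a ⟨adjB u h1 h2 hu, h4.symm, h3, e, h2, fun e => hnab e.symm⟩
  · exact Finset.one_lt_card.2 ⟨a, by simp [hab, hnab], x, by simp [hxb, hnxb], hax.ne⟩
  · exact Finset.one_lt_card.2 ⟨b, by simp [hab.symm, hnab, G.adj_comm b a], y,
      by simp [hya, hnya], hby.ne⟩
  · exact ⟨r, by simp [har.symm, hrb]⟩

theorem statement14 {V : Type*} [Fintype V] [DecidableEq V] (n : ℕ) (hn : 5 ≤ n)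
    (G : SimpleGraph V) [DecidableRel G.Adj]
    (hG : memG1Family G n) (hco : IsCograph G) (hdiam : G.diam = 2)
    (v1 v2 v3 : V) (h12 : G.Adj v1 v2) (h23 : G.Adj v2 v3) (hdist : G.dist v1 v3 = 2) :
    (Sset G {v1, v2, v3} {v1, v2}).Nonempty → Sset G {v1, v2, v3} {v2, v3} = ∅ := by
  obtain ⟨hconn, hcard, ⟨θ, hθ⟩, -, hind⟩ := hG
  rintro ⟨x, hxP, hx⟩
  by_contra hne
  obtain ⟨y, hyP, hy⟩ := Set.nonempty_iff_ne_empty.2 hne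
  have hn13 : ¬ G.Adj v1 v3 := fun e => by
    rw [SimpleGraph.dist_eq_one_iff_adj.2 e] at hdist; omega
  have hne13 : v1 ≠ v3 := by rintro rfl; simp at hdist
  simp only [Set.mem_insert_iff, Set.mem_singleton_iff, not_or] at hxP hyP
  have hx1 : G.Adj x v1 := ((Set.ext_iff.1 hx v1).2 (by simp)).1
  have hx3 : ¬ G.Adj x v3 := fun e => by
    have := (Set.ext_iff.1 hx v3).1 ⟨e, by simp⟩
    simp [hne13.symm, h23.ne'] at this
  have hy3 : G.Adj y v3 := ((Set.ext_iff.1 hy v3).2 (by simp)).1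
  have hy1 : ¬ G.Adj y v1 := fun e => by
    have := (Set.ext_iff.1 hy v1).1 ⟨e, by simp⟩
    simp [hne13, h12.ne] at this
  have hJ := isJoinTwoCliques_of_isCograph hind hco hne13 hn13 h12 h23 hx1.symm hx3 hxP.2.2
    hy3.symm hy1 hyP.1
  have : Nontrivial V := ⟨v1, v3, hne13⟩
  have hrank : (adjSubDeg G (1 - θ)).rank = 3 := by
    rw [rank_adjSubDeg G fun u => hconn.preconnected.degree_pos_of_nontrivial u]
    have := rank_add_eigMult (normLap G) θ
    omega
  have m1 : v1 ∈ ({u | u ≠ v3 ∧ ¬ G.Adj u v3} : Finset V) := by simp [hne13, hn13]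
  have mx : x ∈ ({u | u ≠ v3 ∧ ¬ G.Adj u v3} : Finset V) := by simp [hxP, hx3]
  have m3 : v3 ∈ ({u | u ≠ v1 ∧ ¬ G.Adj u v1} : Finset V) := by
    simp [hne13.symm, hn13, G.adj_comm v3 v1]
  have my : y ∈ ({u | u ≠ v1 ∧ ¬ G.Adj u v1} : Finset V) := by simp [hyP, hy1]
  rcases hJ.sq_eq_one_or (hrank.trans_lt (by norm_num)) m1 mx hx1.ne' m3 my hy3.ne' with h | h
  · exact hJ.false_of_rank_eq_three hrank m1 h
  · exact hJ.symm.false_of_rank_eq_three hrank m3 h
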